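/- Let χ₁, χ₂ be primitive Dirichlet characters of conductors q₁, q₂ respectively, with q₁, q₂ > 1 and χ₁(−1)χ₂(−1) = 1. Let γ = (a b; c d) be a matrix in Γ₀(q₁q₂) with c ≥ 1. Then for every z in the upper half-plane ℍ, (τ(conj(χ₁))/(πi)) · ( f_{χ₁,χ₂}(γ·z) − ψ(d)·f_{χ₁,χ₂}(z) ) = ∑_{j=0}^{c−1} ∑_{n=0}^{q₁−1} conj(χ₂)(j) · conj(χ₁)(n) · B₁(j/c) · B₁(n/q₁ + a·j/c), where γ·z = (az+b)/(cz+d). -/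

import Mathlib

open Complex

/-- `e(w) = exp(2πiw)`. -/
noncomputable def eC (w : ℂ) : ℂ := Complex.exp (2 * Real.pi * Complex.I * w)

/-- The holomorphic part `f_{χ₁,χ₂}(z) = ∑_{l≥1} ∑_{k≥1} (χ₁(l) conj(χ₂)(k) / l) e(klz)`. -/
noncomputable def fE {q₁ q₂ : ℕ} (χ₁ : DirichletCharacter ℂ q₁)
    (χ₂ : DirichletCharacter ℂ q₂) (z : ℂ) : ℂ :=
  ∑' l : ℕ+, ∑' k : ℕ+,
    χ₁ ((l : ℕ) : ZMod q₁) * (starRingEnd ℂ) (χ₂ ((k : ℕ) : ZMod q₂)) / (l : ℂ)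
      * eC ((k : ℂ) * (l : ℂ) * z)

/-- The Gauss sum `τ(χ) = ∑_{n mod q} χ(n) e(n/q)`. -/
noncomputable def gaussSum' {q : ℕ} (χ : DirichletCharacter ℂ q) : ℂ :=
  ∑ n ∈ Finset.range q, χ ((n : ℕ) : ZMod q) * eC ((n : ℂ) / (q : ℂ))

/-- The first Bernoulli function, `B₁(x) = x - ⌊x⌋ - 1/2` off ℤ, and `0` on ℤ. -/
noncomputable def B1 (x : ℝ) : ℝ := if Int.fract x = 0 then 0 else Int.fract x - 1 / 2

open Filter Topology

lemma lin_lower (w : ℂ) (hw : 0 < w.im) : ∃ δ : ℝ, 0 < δ ∧ ∀ l n : ℤ,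
    δ * (|(l : ℝ)| + |(n : ℝ)|) ≤ ‖(l : ℂ) * w + n‖ := by
  have h1 : ∀ l n : ℤ, |(l : ℝ)| * w.im ≤ ‖(l : ℂ) * w + n‖ := by
    intro l n
    have := Complex.abs_im_le_norm ((l : ℂ) * w + n)
    simp [abs_mul, abs_of_pos hw] at this
    exact this
  have h2 : ∀ l n : ℤ, |(n : ℝ)| ≤ ‖(l : ℂ) * w + n‖ + |(l : ℝ)| * ‖w‖ := by
    intro l n
    have := norm_sub_le ((l : ℂ) * w + n) (l * w)
    simpa using this
  refine ⟨w.im / (1 + w.im + ‖w‖), by positivity, fun l n => ?_⟩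
  have a1 := h1 l n
  have a2 := h2 l n
  have hn := norm_nonneg w
  rw [div_mul_eq_mul_div, div_le_iff₀ (by positivity)]
  have := mul_le_mul_of_nonneg_left a2 hw.le
  have := mul_le_mul_of_nonneg_left a1 hn
  nlinarith

lemma summable_sq1 : Summable (fun n : ℤ => 1 / (|(n : ℝ)| * √|(n : ℝ)|)) := by
  have := (Real.summable_one_div_int_add_rpow 0 (3 / 2)).2 (by norm_num)
  refine this.congr fun n => ?_
  rcases eq_or_ne n 0 with rfl | h
  · simp
  · have : 0 < |(n : ℝ)| := by positivity
    rw [add_zero, show (3 / 2 : ℝ) = 1 + 1 / 2 by norm_num, Real.rpow_add this, Real.rpow_one,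
      Real.sqrt_eq_rpow]

lemma summable_sq2 : Summable (fun n : ℤ => 1 / (|(n : ℝ) + 1 / 2| * √|(n : ℝ) + 1 / 2|)) := by
  have := (Real.summable_one_div_int_add_rpow (1 / 2) (3 / 2)).2 (by norm_num)
  refine this.congr fun n => ?_
  have h : (n : ℝ) + 1 / 2 ≠ 0 := by
    intro h
    have h2 : ((2 * n + 1 : ℤ) : ℝ) = 0 := by push_cast; linarith
    have : 2 * n + 1 = 0 := by exact_mod_cast h2
    omega
  have : 0 < |(n : ℝ) + 1 / 2| := by positivity
  rw [show (3 / 2 : ℝ) = 1 + 1 / 2 by norm_num, Real.rpow_add this, Real.rpow_one,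
      Real.sqrt_eq_rpow]

lemma sqrt_lower {δ A x y : ℝ} (hδ : 0 < δ) (hx : 0 ≤ x) (hy : 0 ≤ y) (h1 : δ * x ≤ A)
    (h2 : δ * y ≤ A) : δ * (√x * √y) ≤ A := by
  rw [← Real.sqrt_mul hx]
  have hA : 0 ≤ A := le_trans (by positivity) h1
  have : √(x * y) ≤ A / δ := by
    apply Real.sqrt_le_iff.2 ⟨by positivity, ?_⟩
    rw [sq]
    apply mul_le_mul _ _ hy (by positivity)
    · rw [le_div_iff₀ hδ]; linarith
    · rw [le_div_iff₀ hδ]; linarith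
  rw [le_div_iff₀ hδ] at this
  linarith

/-- `T(l,n) = α(l) p(n) / (l (l w + n))`. -/
noncomputable def coreT (α p : ℤ → ℂ) (w : ℂ) (l n : ℤ) : ℂ := α l * p n / (l * (l * w + n))

/-- The remainder term in the summation by parts. -/
noncomputable def coreE (α p : ℤ → ℂ) (w : ℂ) (l n : ℤ) : ℂ :=
  α l * p (n + 1) * (1 / (l * (l * w + n + 1)) - 1 / (l * (l * w + n)))

lemma lin_ne {w : ℂ} (hw : 0 < w.im) {l : ℤ} (hl : l ≠ 0) (n : ℤ) : (l : ℂ) * w + n ≠ 0 := by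
  intro h
  have := congrArg Complex.im h
  simp [hl, hw.ne'] at this

lemma lin_ne' {w : ℂ} (hw : 0 < w.im) {l : ℤ} (hl : l ≠ 0) (n : ℤ) :
    (l : ℂ) * w + n + 1 ≠ 0 := by
  have := lin_ne hw hl (n + 1)
  push_cast at this
  rwa [add_assoc]

lemma coreE_summable (α p : ℤ → ℂ) (w : ℂ) (hw : 0 < w.im) (hα : ∀ l, ‖α l‖ ≤ 1) (hα0 : α 0 = 0)
    (C : ℝ) (hp : ∀ n, ‖p n‖ ≤ C) :
    Summable (fun v : ℤ × ℤ => coreE α p w v.1 v.2) := by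
  obtain ⟨δ, hδ, hlow⟩ := lin_lower w hw
  have hC : 0 ≤ C := (norm_nonneg _).trans (hp 0)
  have hs := (summable_sq1.mul_of_nonneg summable_sq2 (fun n => by positivity)
    (fun n => by positivity)).mul_left (C / δ ^ 2)
  refine Summable.of_norm_bounded hs ?_
  rintro ⟨l, n⟩
  simp only
  rcases eq_or_ne l 0 with rfl | hl
  · simp [coreE, hα0]
  have e1 := lin_ne hw hl n
  have e2 := lin_ne' hw hl n
  have hl' : (l : ℂ) ≠ 0 := by exact_mod_cast hl
  have : coreE α p w l n = α l * p (n + 1) * (-1 / (l * (l * w + n) * (l * w + n + 1))) := by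
    unfold coreE
    congr 1
    field_simp
    ring
  rw [this, norm_mul, norm_mul, norm_div, norm_mul, norm_mul, norm_neg, norm_one, Complex.norm_intCast]
  have hl1 : (1 : ℝ) ≤ |(l : ℝ)| := by
    have := Int.one_le_abs hl
    exact_mod_cast this
  set x := |(l : ℝ)|
  set y := |(n : ℝ) + 1 / 2| with hy
  have hy0 : 0 < y := by
    apply abs_pos.2
    intro h
    have h2 : ((2 * n + 1 : ℤ) : ℝ) = 0 := by push_cast; linarith
    have : 2 * n + 1 = 0 := by exact_mod_cast h2
    omega
  have hyA : y ≤ x + |(n : ℝ)| := by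
    have := abs_add_le (n : ℝ) (1 / 2)
    rw [abs_of_pos (by norm_num : (0 : ℝ) < 1 / 2)] at this
    linarith
  have hyB : y ≤ x + |((n + 1 : ℤ) : ℝ)| := by
    have := abs_sub ((n + 1 : ℤ) : ℝ) (1 / 2)
    rw [abs_of_pos (by norm_num : (0 : ℝ) < 1 / 2)] at this
    have h3 : ((n + 1 : ℤ) : ℝ) - 1 / 2 = n + 1 / 2 := by push_cast; ring
    rw [h3] at this
    linarith
  have b1 : δ * (√x * √y) ≤ ‖(l : ℂ) * w + n‖ := by
    apply sqrt_lower hδ (by positivity) hy0.le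
    · refine le_trans ?_ (hlow l n)
      gcongr
      have := abs_nonneg (n : ℝ); linarith
    · exact le_trans (by gcongr) (hlow l n)
  have b2 : δ * y ≤ ‖(l : ℂ) * w + n + 1‖ := by
    have := hlow l (n + 1)
    push_cast at this hyB
    rw [add_assoc ((l : ℂ) * w)]
    exact le_trans (by gcongr) this
  have hx0 : 0 < x := by linarith
  have hsx : 0 < √x := Real.sqrt_pos.2 hx0
  have hsy : 0 < √y := Real.sqrt_pos.2 hy0
  have key : δ ^ 2 * ((x * √x) * (y * √y)) ≤ x * ‖(l : ℂ) * w + n‖ * ‖(l : ℂ) * w + n + 1‖ := by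
    calc δ ^ 2 * ((x * √x) * (y * √y)) = x * (δ * (√x * √y)) * (δ * y) := by ring
      _ ≤ _ := by gcongr
  calc ‖α l‖ * ‖p (n + 1)‖ * (1 / (x * ‖(l : ℂ) * w + n‖ * ‖(l : ℂ) * w + n + 1‖))
      ≤ 1 * C * (1 / (δ ^ 2 * ((x * √x) * (y * √y)))) := by
        gcongr
        · exact hα l
        · exact hp _
    _ = C / δ ^ 2 * (1 / (x * √x) * (1 / (y * √y))) := by
        field_simp

lemma sum_Ico_int_telescope (T : ℤ → ℂ) (A : ℤ) (m : ℕ) :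
    ∑ n ∈ Finset.Ico A (A + m), (T (n + 1) - T n) = T (A + m) - T A := by
  induction m with
  | zero => simp
  | succ m ih =>
    have : Finset.Ico A (A + (m + 1 : ℕ)) = insert (A + m) (Finset.Ico A (A + m)) := by
      ext x; simp; omega
    rw [this, Finset.sum_insert (by simp), ih]
    push_cast
    ring_nf

lemma sum_Ico_int_telescope' (T : ℤ → ℂ) {A B : ℤ} (h : A ≤ B) :
    ∑ n ∈ Finset.Ico A B, (T (n + 1) - T n) = T B - T A := by
  obtain ⟨m, rfl⟩ := Int.le.dest h
  exact sum_Ico_int_telescope T A m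

/-- Windows of integers made of full periods. -/
noncomputable def win (q : ℕ) (N : ℕ) : Finset ℤ := Finset.Ico (-(q * N : ℤ)) (q * (N + 1))

lemma win_tendsto {q : ℕ} (hq : 0 < q) : Tendsto (win q) atTop atTop := by
  apply Filter.tendsto_atTop_finset_of_monotone
  · intro N M h
    unfold win
    have : (q : ℤ) * N ≤ q * M := by exact_mod_cast Nat.mul_le_mul_left q h
    apply Finset.Ico_subset_Ico <;> linarith
  · intro x
    refine ⟨x.natAbs, ?_⟩
    unfold win
    have h1 : (1 : ℤ) ≤ q := by exact_mod_cast hq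
    have h2 : |x| ≤ q * |x| := by nlinarith [abs_nonneg x]
    simp only [Finset.mem_Ico, Int.natCast_natAbs]
    have := neg_abs_le x
    have := le_abs_self x
    constructor <;> nlinarith

lemma coreE_eq {α p β : ℤ → ℂ} (hpβ : ∀ n, p (n + 1) - p n = β n) (w : ℂ) (l n : ℤ) :
    coreE α p w l n = coreT α p w l (n + 1) - coreT α p w l n
      - α l * β n / (l * (l * w + n)) := by
  unfold coreE coreT
  rw [← hpβ]
  push_cast
  rw [← add_assoc]
  ring

lemma coreE_hasSum_fiber {α p β : ℤ → ℂ} (hpβ : ∀ n, p (n + 1) - p n = β n) {q : ℕ} (hq : 0 < q)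
    (hpq : ∀ m : ℤ, p (q * m) = 0) (w : ℂ) (hw : 0 < w.im) (hα0 : α 0 = 0) (Φ : ℂ → ℂ)
    (hΦ : ∀ w : ℂ, (∀ n : ℤ, w + n ≠ 0) →
      Tendsto (fun N => ∑ n ∈ win q N, β n / (w + n)) atTop (𝓝 (Φ w)))
    (hE : Summable (fun v : ℤ × ℤ => coreE α p w v.1 v.2)) (l : ℤ) :
    HasSum (fun n => coreE α p w l n) (-(α l / l * Φ (l * w))) := by
  rcases eq_or_ne l 0 with rfl | hl
  · simp [coreE, hα0]
  have hs : Summable (fun n => coreE α p w l n) := hE.prod_factor l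
  have h1 : Tendsto (fun N => ∑ n ∈ win q N, coreE α p w l n) atTop (𝓝 (∑' n, coreE α p w l n)) :=
    hs.hasSum.comp (win_tendsto hq)
  have h2 : ∀ N, ∑ n ∈ win q N, coreE α p w l n
      = -(α l / l * ∑ n ∈ win q N, β n / (l * w + n)) := by
    intro N
    simp_rw [coreE_eq hpβ]
    rw [Finset.sum_sub_distrib]
    unfold win
    rw [sum_Ico_int_telescope']
    · have e1 : coreT α p w l (q * (N + 1)) = 0 := by
        have := hpq (N + 1)
        simp [coreT, this]
      have e2 : coreT α p w l (-(q * N)) = 0 := by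
        have := hpq (-N)
        rw [mul_neg] at this
        simp [coreT, this]
      rw [e1, e2, sub_zero, zero_sub, Finset.mul_sum]
      congr 1
      apply Finset.sum_congr rfl
      intro n _
      rw [div_mul_div_comm]
    · have : (0 : ℤ) ≤ q * N := by positivity
      have : (0 : ℤ) ≤ q := by positivity
      nlinarith
  have h3 := ((hΦ (l * w) (fun n => lin_ne hw hl n)).const_mul (α l / l)).neg
  simp_rw [h2] at h1
  have := tendsto_nhds_unique h1 h3
  rw [← this]
  exact hs.hasSum

/-- A shift does not change symmetric sums of a null sequence, in the limit. -/
lemma tendsto_shift_zero (G : ℤ → ℂ) (hG : Tendsto G cofinite (𝓝 0)) (c : ℕ) :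
    Tendsto (fun X : ℕ => ∑ l ∈ Finset.Ico (-X : ℤ) X, (G (l - c) - G l)) atTop (𝓝 0) := by
  induction c with
  | zero => simp
  | succ c ih =>
    have h : ∀ X : ℕ, ∑ l ∈ Finset.Ico (-X : ℤ) X, (G (l - (c + 1 : ℕ)) - G l)
      = (∑ l ∈ Finset.Ico (-X : ℤ) X, (G (l - c) - G l))
        - (G (X - (c + 1)) - G (-X - (c + 1))) := by
      intro X
      have := sum_Ico_int_telescope' (fun l => G (l - (c + 1))) (A := -X) (B := X) (by omega)
      rw [← this, ← Finset.sum_sub_distrib]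
      apply Finset.sum_congr rfl
      intro l _
      push_cast
      rw [show l + 1 - ((c : ℤ) + 1) = l - c by ring]
      ring
    simp_rw [h]
    have i1 : Tendsto (fun X : ℕ => G (X - (c + 1))) atTop (𝓝 0) := by
      refine hG.comp ?_
      rw [← Nat.cofinite_eq_atTop]
      apply Function.Injective.tendsto_cofinite
      intro x y h; simpa using h
    have i2 : Tendsto (fun X : ℕ => G (-X - (c + 1))) atTop (𝓝 0) := by
      refine hG.comp ?_
      rw [← Nat.cofinite_eq_atTop]
      apply Function.Injective.tendsto_cofinite
      intro x y h; simpa using h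
    simpa using ih.sub (i1.sub i2)

lemma coreT_bound (α p : ℤ → ℂ) (w : ℂ) (hw : 0 < w.im) (hα : ∀ l, ‖α l‖ ≤ 1) (hα0 : α 0 = 0)
    (C : ℝ) (hp : ∀ n, ‖p n‖ ≤ C) (a b c d : ℤ) (hdet : a * d - b * c = 1) (hc : 0 < c) :
    ∃ K : ℝ, 0 ≤ K ∧ ∀ l n : ℤ, (l ≠ 0 →
      ‖coreT α p w (l * a + n * c) (l * b + n * d)‖ ≤
      K * (1 / (|((l * a + n * c : ℤ) : ℝ)| * √|((l * a + n * c : ℤ) : ℝ)|)) *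
        (1 / √(|(l : ℝ)|))) ∧
      ‖coreT α p w (l * a + n * c) (l * b + n * d)‖ ≤
      K * (1 / (|((l * a + n * c : ℤ) : ℝ)| * √|((l * a + n * c : ℤ) : ℝ)|)) := by
  obtain ⟨δ, hδ, hlow⟩ := lin_lower w hw
  have hC : 0 ≤ C := (norm_nonneg _).trans (hp 0)
  -- lower bound through l
  set M : ℝ := |(c : ℝ)| + |(d : ℝ)| with hM
  have hM0 : 0 < M := by
    have : 0 < |(c : ℝ)| := abs_pos.2 (by exact_mod_cast hc.ne')
    positivity
  set ε : ℝ := min δ (δ / M) with hε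
  have hε0 : 0 < ε := by positivity
  refine ⟨C / ε, by positivity, fun l n => ?_⟩
  set m := l * a + n * c with hm
  set k := l * b + n * d with hk
  rcases eq_or_ne m 0 with h0 | h0
  · simp [coreT, h0, hα0]
  have hl : l = d * m - c * k := by
    rw [hm, hk]; linear_combination (-l) * hdet
  have hx1 : (1 : ℝ) ≤ |(m : ℝ)| := by exact_mod_cast Int.one_le_abs h0
  set x := |(m : ℝ)|
  have hx0 : 0 < x := by linarith
  have hsx : 1 ≤ √x := by rw [Real.one_le_sqrt]; exact hx1
  have c1 : ε * x ≤ ‖(m : ℂ) * w + k‖ := by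
    refine le_trans ?_ (hlow m k)
    have := abs_nonneg (k : ℝ)
    have : ε ≤ δ := min_le_left _ _
    gcongr
    linarith
  have c2 : ε * |(l : ℝ)| ≤ ‖(m : ℂ) * w + k‖ := by
    refine le_trans ?_ (hlow m k)
    have e1 : |(l : ℝ)| ≤ M * (x + |(k : ℝ)|) := by
      rw [hl]; push_cast
      calc |(d : ℝ) * m - c * k| ≤ |(d : ℝ) * m| + |(c : ℝ) * k| := abs_sub _ _
        _ = |(d : ℝ)| * x + |(c : ℝ)| * |(k : ℝ)| := by rw [abs_mul, abs_mul]
        _ ≤ _ := by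
          rw [hM]
          have := abs_nonneg (k : ℝ)
          have := abs_nonneg (c : ℝ)
          have := abs_nonneg (d : ℝ)
          nlinarith [mul_nonneg (abs_nonneg (c : ℝ)) hx0.le,
            mul_nonneg (abs_nonneg (d : ℝ)) (abs_nonneg (k : ℝ))]
    have : ε ≤ δ / M := min_le_right _ _
    calc ε * |(l : ℝ)| ≤ δ / M * (M * (x + |(k : ℝ)|)) := by gcongr
      _ = δ * (x + |(k : ℝ)|) := by field_simp
  have c3 := sqrt_lower hε0 hx0.le (abs_nonneg _) c1 c2
  have c4 : ε * √x ≤ ‖(m : ℂ) * w + k‖ := by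
    refine le_trans ?_ c1
    gcongr
    have := Real.mul_self_sqrt hx0.le
    nlinarith
  have hT : ‖coreT α p w m k‖ = ‖α m‖ * ‖p k‖ / (x * ‖(m : ℂ) * w + k‖) := by
    unfold coreT
    rw [norm_div, norm_mul, norm_mul, Complex.norm_intCast]
  have hN : ‖α m‖ * ‖p k‖ ≤ C := by
    calc ‖α m‖ * ‖p k‖ ≤ 1 * C := by
          gcongr
          · exact hα m
          · exact hp k
      _ = C := one_mul C
  have part2 : ‖coreT α p w m k‖ ≤ C / ε * (1 / (x * √x)) := by
    rw [hT]
    calc _ ≤ C / (x * (ε * √x)) := by gcongr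
      _ = _ := by field_simp
  refine ⟨?_, part2⟩
  intro hl0
  rw [hT]
  have : 0 < |(l : ℝ)| := abs_pos.2 (by exact_mod_cast hl0)
  have hs2 : 0 < √|(l : ℝ)| := Real.sqrt_pos.2 this
  calc _ ≤ C / (x * (ε * (√x * √|(l : ℝ)|))) := by gcongr
    _ = _ := by field_simp

lemma core_main {α p β : ℤ → ℂ} (hpβ : ∀ n, p (n + 1) - p n = β n) {q : ℕ} (hq : 0 < q)
    (hpq : ∀ m : ℤ, p (q * m) = 0) (C : ℝ) (hp : ∀ n, ‖p n‖ ≤ C)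
    (hα : ∀ l, ‖α l‖ ≤ 1) (hα0 : α 0 = 0) (Φ : ℂ → ℂ)
    (hΦ : ∀ w : ℂ, (∀ n : ℤ, w + n ≠ 0) →
      Tendsto (fun N => ∑ n ∈ win q N, β n / (w + n)) atTop (𝓝 (Φ w)))
    (a b c d : ℤ) (hdet : a * d - b * c = 1) (hc : 0 < c) (κ : ℂ)
    (hinv : ∀ l n : ℤ, α (l * a + n * c) * β (l * b + n * d) = κ * (α l * β n))
    (hαc : ∀ l n : ℤ, α l ≠ 0 → l * a + n * c ≠ 0)
    (w : ℂ) (hw : 0 < w.im) (w' : ℂ) (hw' : 0 < w'.im) (hww : w' * (c * w + d) = a * w + b) :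
    Summable (fun l : ℤ => α l / l * Φ (l * w)) ∧
    Summable (fun l : ℤ => α l / l * Φ (l * w')) ∧
    Tendsto (fun X : ℕ => κ * ∑ l ∈ Finset.Ico (-X : ℤ) X, α l / l * Φ (l * a / c)) atTop
      (𝓝 (κ * ∑' l : ℤ, α l / l * Φ (l * w') - ∑' l : ℤ, α l / l * Φ (l * w))) := by
  have hE := coreE_summable α p w hw hα hα0 C hp
  have hE' := coreE_summable α p w' hw' hα hα0 C hp
  have S1 : HasSum (fun l : ℤ => α l / l * Φ (l * w)) (-∑' v : ℤ × ℤ, coreE α p w v.1 v.2) := by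
    have := (hE.hasSum.prod_fiberwise (fun l => coreE_hasSum_fiber hpβ hq hpq w hw hα0 Φ hΦ hE l)).neg
    simpa using this
  have S1' : HasSum (fun l : ℤ => α l / l * Φ (l * w'))
      (-∑' v : ℤ × ℤ, coreE α p w' v.1 v.2) := by
    have := (hE'.hasSum.prod_fiberwise
      (fun l => coreE_hasSum_fiber hpβ hq hpq w' hw' hα0 Φ hΦ hE' l)).neg
    simpa using this
  refine ⟨S1.summable, S1'.summable, ?_⟩
  -- the change of variables
  let e : ℤ × ℤ ≃ ℤ × ℤ :=
    { toFun := fun v => (v.1 * a + v.2 * c, v.1 * b + v.2 * d)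
      invFun := fun v => (v.1 * d - v.2 * c, v.2 * a - v.1 * b)
      left_inv := by
        rintro ⟨l, n⟩
        ext
        · simp only; linear_combination l * hdet
        · simp only; linear_combination n * hdet
      right_inv := by
        rintro ⟨l, n⟩
        ext
        · simp only; linear_combination l * hdet
        · simp only; linear_combination n * hdet }
  have hEt : HasSum (fun v : ℤ × ℤ => coreE α p w (v.1 * a + v.2 * c) (v.1 * b + v.2 * d))
      (∑' v : ℤ × ℤ, coreE α p w v.1 v.2) := (e.hasSum_iff).2 hE.hasSum
  have hEf : ∀ l : ℤ, Summable (fun n : ℤ => coreE α p w (l * a + n * c) (l * b + n * d)) :=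
    fun l => hEt.summable.prod_factor l
  have hes := hEt.prod_fiberwise (fun l => (hEf l).hasSum)
  -- summability of T
  obtain ⟨K, hK, hTb⟩ := coreT_bound α p w hw hα hα0 C hp a b c d hdet hc
  have hinj : ∀ l : ℤ, Function.Injective (fun n : ℤ => l * a + n * c) := by
    intro l x y h
    simp only at h
    have : x * c = y * c := by linarith
    exact Int.eq_of_mul_eq_mul_right hc.ne' this
  have hZs : ∀ l : ℤ, Summable (fun n : ℤ => 1 / (|((l * a + n * c : ℤ) : ℝ)| *
      √|((l * a + n * c : ℤ) : ℝ)|)) := fun l => summable_sq1.comp_injective (hinj l)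
  have hTs : ∀ l : ℤ, Summable (fun n : ℤ => coreT α p w (l * a + n * c) (l * b + n * d)) :=
    fun l => Summable.of_norm_bounded ((hZs l).mul_left K) (fun n => (hTb l n).2)
  set G : ℤ → ℂ := fun l => ∑' n : ℤ, coreT α p w (l * a + n * c) (l * b + n * d) with hGdef
  set Z : ℝ := ∑' n : ℤ, 1 / (|(n : ℝ)| * √|(n : ℝ)|) with hZ
  have hG : Tendsto G cofinite (𝓝 0) := by
    have hb : ∀ l : ℤ, l ≠ 0 → ‖G l‖ ≤ K * Z * (1 / √|(l : ℝ)|) := by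
      intro l hl
      have h1 : ‖G l‖ ≤ ∑' n : ℤ, K * (1 / (|((l * a + n * c : ℤ) : ℝ)| *
          √|((l * a + n * c : ℤ) : ℝ)|)) * (1 / √(|(l : ℝ)|)) :=
        tsum_of_norm_bounded (((hZs l).mul_left K).mul_right _).hasSum (fun n => (hTb l n).1 hl)
      rw [tsum_mul_right, tsum_mul_left] at h1
      refine h1.trans ?_
      gcongr
      exact tsum_comp_le_tsum_of_inj summable_sq1 (fun n => by positivity) (hinj l)
    have hlim : Tendsto (fun l : ℤ => K * Z * (1 / √|(l : ℝ)|)) cofinite (𝓝 0) := by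
      have : Tendsto (fun l : ℤ => √|(l : ℝ)|) cofinite atTop := by
        refine Real.tendsto_sqrt_atTop.comp ?_
        have := tendsto_norm_cocompact_atTop (E := ℤ)
        rw [cocompact_eq_cofinite] at this
        exact this.congr fun l => Int.norm_eq_abs l
      simpa using (this.inv_tendsto_atTop).const_mul (K * Z)
    refine squeeze_zero_norm' ?_ hlim
    have : ∀ᶠ l : ℤ in cofinite, l ≠ 0 := by
      rw [Filter.eventually_cofinite]; simp
    filter_upwards [this] with l hl using hb l hl
  -- the fiberwise identity
  have hmain : ∀ l : ℤ, κ * (α l / l * Φ (l * w')) - κ * (α l / l * Φ (l * a / c)) =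
      (G (l - c) - G l) - ∑' n : ℤ, coreE α p w (l * a + n * c) (l * b + n * d) := by
    intro l
    have hsh : HasSum (fun n : ℤ => coreT α p w (l * a + n * c) (l * b + n * d + 1)) (G (l - c)) := by
      have := ((Equiv.addRight a).hasSum_iff).2 (hTs (l - c)).hasSum
      convert this using 2 with n
      simp only [Function.comp_apply, Equiv.coe_addRight]
      congr 1
      · ring
      · linear_combination -hdet
    have hh : HasSum (fun n : ℤ => α (l * a + n * c) * β (l * b + n * d) /
        (((l * a + n * c : ℤ) : ℂ) * (((l * a + n * c : ℤ) : ℂ) * w + ((l * b + n * d : ℤ) : ℂ))))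
        ((G (l - c) - G l) - ∑' n : ℤ, coreE α p w (l * a + n * c) (l * b + n * d)) := by
      have := (hsh.sub (hTs l).hasSum).sub (hEf l).hasSum
      have hfe : (fun n : ℤ => α (l * a + n * c) * β (l * b + n * d) /
          (((l * a + n * c : ℤ) : ℂ) * (((l * a + n * c : ℤ) : ℂ) * w + ((l * b + n * d : ℤ) : ℂ))))
          = fun n : ℤ => coreT α p w (l * a + n * c) (l * b + n * d + 1)
            - coreT α p w (l * a + n * c) (l * b + n * d)
            - coreE α p w (l * a + n * c) (l * b + n * d) := by
        funext n
        rw [coreE_eq hpβ]; ring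
      rw [hfe]
      exact this
    by_cases hl : α l = 0
    · have : ∀ n : ℤ, α (l * a + n * c) * β (l * b + n * d) = 0 := by
        intro n; rw [hinv, hl]; ring
      simp_rw [this] at hh
      rw [hl]
      simp only [zero_div] at hh
      rw [hh.unique hasSum_zero]; simp
    · have hl0 : l ≠ 0 := by rintro rfl; exact hl hα0
      have t1 := hh.comp (win_tendsto hq)
      have hcC : (c : ℂ) ≠ 0 := by exact_mod_cast hc.ne'
      have hlC : (l : ℂ) ≠ 0 := by exact_mod_cast hl0
      have hmne : ∀ n : ℤ, (l : ℂ) * a + n * c ≠ 0 := by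
        intro n; exact_mod_cast hαc l n hl
      have t2 := hΦ (l * w') (fun n => lin_ne hw' hl0 n)
      have t3 := hΦ (l * a / c) (fun n h => hmne n (by field_simp at h; linear_combination h))
      have t4 := ((t2.const_mul (κ * (α l / l))).sub (t3.const_mul (κ * (α l / l))))
      rw [mul_assoc, mul_assoc] at t4
      refine tendsto_nhds_unique t4 (t1.congr fun N => ?_)
      rw [← mul_sub, ← Finset.sum_sub_distrib, Finset.mul_sum]
      apply Finset.sum_congr rfl
      intro n _
      beta_reduce
      rw [hinv]
      have n1 := lin_ne hw' hl0 n
      have n2 := hmne n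
      have n3 : (l : ℂ) * a / c + n ≠ 0 := fun h => hmne n (by field_simp at h; linear_combination h)
      have n4 := lin_ne hw (hαc l n hl) (l * b + n * d)
      push_cast at n4 ⊢
      have hdC : (a : ℂ) * d - b * c = 1 := by exact_mod_cast hdet
      have k1 : ((l : ℂ) * w' + n) * (c * w + d) = (l * a + n * c) * w + (l * b + n * d) := by
        linear_combination (l : ℂ) * hww
      have n5 : (c : ℂ) * w + d ≠ 0 := by
        intro h
        rw [h, mul_zero] at k1
        exact n4 k1.symm
      have k2 : (l : ℂ) * a / c + n = (l * a + n * c) / c := by field_simp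
      have k3 : ((l : ℂ) * a + n * c) / c - (l * w' + n) = l / (c * (c * w + d)) := by
        field_simp
        linear_combination (l : ℂ) * hdC - (l : ℂ) * c * hww
      rw [← k1, k2, div_sub_div _ _ n1 (k2 ▸ n3),
        show β n * (((l : ℂ) * a + n * c) / c) - ((l : ℂ) * w' + n) * β n
          = β n * (((l : ℂ) * a + n * c) / c - (l * w' + n)) by ring, k3]
      field_simp
  have hfin : ∀ X : ℕ, κ * ∑ l ∈ Finset.Ico (-X : ℤ) X, α l / l * Φ (l * a / c) =
      κ * ∑ l ∈ Finset.Ico (-X : ℤ) X, α l / l * Φ (l * w')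
      - ∑ l ∈ Finset.Ico (-X : ℤ) X, (G (l - c) - G l)
      + ∑ l ∈ Finset.Ico (-X : ℤ) X, ∑' n : ℤ, coreE α p w (l * a + n * c) (l * b + n * d) := by
    intro X
    rw [Finset.mul_sum, Finset.mul_sum, ← Finset.sum_sub_distrib, ← Finset.sum_add_distrib]
    apply Finset.sum_congr rfl
    intro l _
    linear_combination -hmain l
  simp_rw [hfin]
  obtain ⟨c', rfl⟩ := Int.eq_ofNat_of_zero_le hc.le
  have r1 := (S1'.summable.hasSum.comp (Finset.tendsto_Ico_neg (R := ℤ))).const_mul κ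
  have r2 := tendsto_shift_zero G hG c'
  have r3 := hes.comp (Finset.tendsto_Ico_neg (R := ℤ))
  have := (r1.sub r2).add r3
  rw [S1.tsum_eq]
  simpa [Function.comp_def] using this

lemma sum_range_zmod {q : ℕ} [NeZero q] (f : ZMod q → ℂ) :
    ∑ s ∈ Finset.range q, f (s : ZMod q) = ∑ x : ZMod q, f x := by
  refine Finset.sum_nbij' (fun s => (s : ZMod q)) (fun x => x.val) ?_ ?_ ?_ ?_ ?_
  · simp
  · intro x _; simp [ZMod.val_lt]
  · intro s hs; simp only [Finset.mem_range] at hs; simp [ZMod.val_natCast, Nat.mod_eq_of_lt hs]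
  · intro x _; simp
  · simp

lemma eC_eq_std {q : ℕ} [NeZero q] (j : ℤ) :
    eC ((j : ℂ) / q) = ZMod.stdAddChar (N := q) (j : ZMod q) := by
  rw [ZMod.stdAddChar_coe]
  unfold eC
  congr 1
  ring

lemma gaussSum'_eq {q : ℕ} [NeZero q] (χ : DirichletCharacter ℂ q) :
    gaussSum' χ = gaussSum χ (ZMod.stdAddChar (N := q)) := by
  unfold gaussSum' gaussSum
  rw [← sum_range_zmod (fun x => χ x * ZMod.stdAddChar x)]
  apply Finset.sum_congr rfl
  intro n _
  have := eC_eq_std (q := q) (n : ℤ)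
  push_cast at this
  rw [this]

lemma gauss_twist {q : ℕ} [NeZero q] (χ : DirichletCharacter ℂ q) (hχ : χ.IsPrimitive) (k : ℤ) :
    ∑ s ∈ Finset.range q, χ (s : ZMod q) * eC ((s : ℂ) * k / q) =
      (starRingEnd ℂ) (χ (k : ZMod q)) * gaussSum' χ := by
  rw [gaussSum'_eq, starRingEnd_apply, MulChar.star_apply', ← gaussSum_mulShift_of_isPrimitive _ hχ]
  unfold gaussSum
  rw [← sum_range_zmod (fun x => χ x * (AddChar.mulShift ZMod.stdAddChar (k : ZMod q)) x)]
  apply Finset.sum_congr rfl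
  intro n _
  have := eC_eq_std (q := q) (k * n : ℤ)
  push_cast at this
  rw [AddChar.mulShift_apply, mul_comm (n : ℂ), this]

lemma gauss_ne_zero {q : ℕ} [NeZero q] (χ : DirichletCharacter ℂ q) (hχ : χ.IsPrimitive) :
    gaussSum' χ ≠ 0 := by
  rw [gaussSum'_eq]
  intro h
  have h1 : ZMod.dft (⇑χ) = 0 := by
    funext k
    rw [hχ.fourierTransform_eq_inv_mul_gaussSum, h]; simp
  have h2 : (⇑χ) = 0 := by
    apply ZMod.dft.injective
    rw [h1, map_zero]
  have := congrFun h2 1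
  simp at this

lemma ringHomComp_conj_eq {q : ℕ} [NeZero q] (χ : DirichletCharacter ℂ q) :
    χ.ringHomComp (starRingEnd ℂ) = χ⁻¹ := by
  ext x
  rw [MulChar.ringHomComp_apply, starRingEnd_apply, MulChar.star_apply']

lemma gauss_twist_conj {q : ℕ} [NeZero q] (χ : DirichletCharacter ℂ q) (hχ : χ.IsPrimitive)
    (k : ℤ) :
    ∑ n ∈ Finset.range q, (starRingEnd ℂ) (χ (n : ZMod q)) * eC ((n : ℂ) * k / q) =
      χ (k : ZMod q) * gaussSum' (χ.ringHomComp (starRingEnd ℂ)) := by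
  have hp : DirichletCharacter.IsPrimitive
      (χ.ringHomComp (starRingEnd ℂ) : DirichletCharacter ℂ q) := by
    rw [ringHomComp_conj_eq, DirichletCharacter.isPrimitive_def, DirichletCharacter.conductor_inv]
    exact hχ
  have := gauss_twist _ hp k
  simpa [MulChar.ringHomComp_apply] using this

lemma char_sum_zero {q : ℕ} [NeZero q] (hq : 1 < q) (χ : DirichletCharacter ℂ q)
    (hχ : χ.IsPrimitive) : ∑ s ∈ Finset.range q, χ (s : ZMod q) = 0 := by
  rw [sum_range_zmod (fun x => χ x)]
  apply MulChar.sum_eq_zero_of_ne_one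
  rintro rfl
  rw [DirichletCharacter.isPrimitive_def, DirichletCharacter.conductor_one] at hχ
  omega

/-- Partial sums of a character. -/
noncomputable def charP {q : ℕ} (χ : DirichletCharacter ℂ q) (n : ℤ) : ℂ :=
  ∑ s ∈ Finset.range (n % q).toNat, χ (s : ZMod q)

lemma charP_mul {q : ℕ} (χ : DirichletCharacter ℂ q) (m : ℤ) : charP χ (q * m) = 0 := by
  simp [charP]

lemma charP_bound {q : ℕ} [NeZero q] (χ : DirichletCharacter ℂ q) (n : ℤ) : ‖charP χ n‖ ≤ q := by
  have hq : (0 : ℤ) < q := by exact_mod_cast Nat.pos_of_ne_zero (NeZero.ne q)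
  have h1 := Int.emod_lt_of_pos n hq
  have h2 := Int.emod_nonneg n hq.ne'
  calc ‖charP χ n‖ ≤ ∑ s ∈ Finset.range (n % q).toNat, ‖χ (s : ZMod q)‖ := norm_sum_le _ _
    _ ≤ ∑ s ∈ Finset.range (n % q).toNat, 1 := Finset.sum_le_sum fun s _ => χ.norm_le_one _
    _ = ((n % q).toNat : ℝ) := by simp
    _ ≤ q := by exact_mod_cast (by omega)

lemma charP_succ {q : ℕ} [NeZero q] (hq1 : 1 < q) (χ : DirichletCharacter ℂ q)
    (hχ : χ.IsPrimitive) (n : ℤ) : charP χ (n + 1) - charP χ n = χ (n : ZMod q) := by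
  have hq : (0 : ℤ) < q := by exact_mod_cast Nat.pos_of_ne_zero (NeZero.ne q)
  have h1 := Int.emod_lt_of_pos n hq
  have h2 := Int.emod_nonneg n hq.ne'
  have h3 : (((n % q).toNat : ℕ) : ZMod q) = (n : ZMod q) := by
    have : (((n % q).toNat : ℤ) : ZMod q) = ((n % q : ℤ) : ZMod q) := by
      rw [Int.toNat_of_nonneg h2]
    rw [Int.cast_natCast] at this
    rw [this]
    simp
  unfold charP
  rcases eq_or_ne (n % q) (q - 1) with h | h
  · have e1 : (n + 1) % q = 0 := by
      rw [Int.add_emod, h, Int.emod_eq_of_lt (a := 1) (by norm_num) (by exact_mod_cast hq1)]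
      simp
    have e2 := char_sum_zero hq1 χ hχ
    have e3 : q = (n % q).toNat + 1 := by omega
    have e4 : ∑ s ∈ Finset.range ((n % q).toNat + 1), χ (s : ZMod q) = 0 := by
      rw [← e3]; exact e2
    rw [Finset.sum_range_succ, h3] at e4
    rw [e1]
    simp only [Int.toNat_zero, Finset.range_zero, Finset.sum_empty]
    linear_combination -e4
  · have e1 : (n + 1) % q = n % q + 1 := by
      rw [Int.add_emod, Int.emod_eq_of_lt (a := 1) (by norm_num) (by exact_mod_cast hq1),
        Int.emod_eq_of_lt] <;> omega
    rw [e1, Int.toNat_add h2 (by norm_num), Int.toNat_one, Finset.sum_range_succ, h3]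
    ring

/-- `Φ(w) = ∑_n χ(n)/(w+n)` in closed form. -/
noncomputable def Phi {q : ℕ} (χ : DirichletCharacter ℂ q) (w : ℂ) : ℂ :=
  ∑ s ∈ Finset.range q, χ (s : ZMod q) * (Real.pi / q * Complex.cot (Real.pi * ((w + s) / q)))

lemma sum_Ico_len (F : ℤ → ℂ) (B : ℤ) (q : ℕ) :
    ∑ n ∈ Finset.Ico B (B + q), F n = ∑ s ∈ Finset.range q, F (B + s) := by
  induction q with
  | zero => simp
  | succ m ih =>
    have h1 : Finset.Ico B (B + (m + 1 : ℕ)) = insert (B + m) (Finset.Ico B (B + m)) := by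
      ext x; simp; omega
    rw [h1, Finset.sum_insert (by simp), ih, Finset.sum_range_succ, add_comm]

lemma sum_Ico_blocks (F : ℤ → ℂ) (q : ℕ) (A : ℤ) (m : ℕ) :
    ∑ n ∈ Finset.Ico (q * A) (q * (A + m)), F n =
      ∑ k ∈ Finset.Ico A (A + m), ∑ s ∈ Finset.range q, F (q * k + s) := by
  induction m with
  | zero => simp
  | succ m ih =>
    have h1 : Finset.Ico A (A + (m + 1 : ℕ)) = insert (A + m) (Finset.Ico A (A + m)) := by
      ext x; simp; omega
    rw [h1, Finset.sum_insert (by simp), ← ih]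
    have hq : (0 : ℤ) ≤ q := by positivity
    have h2 : Finset.Ico ((q : ℤ) * A) (q * (A + (m + 1 : ℕ))) =
        Finset.Ico ((q : ℤ) * A) (q * (A + m)) ∪
          Finset.Ico ((q : ℤ) * (A + m)) (q * (A + m) + q) := by
      rw [Finset.Ico_union_Ico_eq_Ico]
      · congr 1; push_cast; ring
      · nlinarith
      · omega
    rw [h2, Finset.sum_union (Finset.Ico_disjoint_Ico_consecutive _ _ _), sum_Ico_len, add_comm]

lemma cot_window (x : ℂ) (hx : ∀ n : ℤ, x + n ≠ 0) :
    Tendsto (fun N : ℕ => ∑ m ∈ Finset.Ico (-N : ℤ) (N + 1), 1 / (x + m)) atTop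
      (𝓝 (Real.pi * Complex.cot (Real.pi * x))) := by
  have hx' : x ∈ Complex.integerComplement := by
    rintro ⟨n, hn⟩
    apply hx (-n)
    rw [← hn]; push_cast; ring
  have h := (tendsto_logDeriv_euler_cot_sub hx').const_add (1 / x)
  rw [add_sub_cancel] at h
  refine h.congr fun N => ?_
  induction N with
  | zero =>
    have h0 : Finset.Ico (0 : ℤ) 1 = {0} := by decide
    simp [h0]
  | succ N ih =>
    have h1 : Finset.Ico (-(N + 1 : ℕ) : ℤ) ((N + 1 : ℕ) + 1) =
      insert (-(N + 1 : ℤ)) (insert (N + 1 : ℤ) (Finset.Ico (-N : ℤ) (N + 1))) := by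
      ext y; simp; omega
    rw [h1, Finset.sum_insert (by simp; omega), Finset.sum_insert (by simp), ← ih,
      Finset.sum_range_succ]
    simp only [cotTerm]
    push_cast
    ring

lemma Phi_tendsto {q : ℕ} [NeZero q] (χ : DirichletCharacter ℂ q) (w : ℂ)
    (hw : ∀ n : ℤ, w + n ≠ 0) :
    Tendsto (fun N => ∑ n ∈ win q N, χ (n : ZMod q) / (w + n)) atTop (𝓝 (Phi χ w)) := by
  have hq0 : (q : ℂ) ≠ 0 := by exact_mod_cast NeZero.ne q
  have hlim : Tendsto (fun N : ℕ => ∑ s ∈ Finset.range q, χ (s : ZMod q) * (1 / q *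
      ∑ m ∈ Finset.Ico (-N : ℤ) (N + 1), 1 / ((w + s) / q + m))) atTop (𝓝 (Phi χ w)) := by
    unfold Phi
    refine tendsto_finsetSum _ fun s _ => ?_
    have := (cot_window ((w + s) / q) (fun n h => hw (s + q * n) (by
      field_simp at h; push_cast; linear_combination h))).const_mul (1 / (q : ℂ))
    convert this.const_mul (χ (s : ZMod q)) using 3
    ring
  refine hlim.congr fun N => ?_
  have hb := sum_Ico_blocks (fun n => χ (n : ZMod q) / (w + n)) q (-N) (2 * N + 1)
  have i1 : win q N = Finset.Ico ((q : ℤ) * (-N)) (q * (-N + (2 * N + 1 : ℕ))) := by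
    unfold win
    congr 1
    · ring
    · push_cast; ring
  rw [i1, hb, Finset.sum_comm]
  apply Finset.sum_congr rfl
  intro s _
  rw [Finset.mul_sum, Finset.mul_sum]
  apply Finset.sum_congr
  · congr 1; push_cast; ring
  · intro m _
    have : (w + s) / q + m ≠ 0 := fun h => hw (s + q * m) (by
      field_simp at h; push_cast; linear_combination h)
    have h2 : w + ((q * m + s : ℤ) : ℂ) = q * ((w + s) / q + m) := by
      push_cast; field_simp; ring
    rw [h2]
    push_cast
    simp only [CharP.cast_eq_zero, zero_mul, zero_add]
    field_simp

lemma eC_add (x y : ℂ) : eC (x + y) = eC x * eC y := by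
  unfold eC; rw [← Complex.exp_add]; congr 1; ring

lemma eC_nat_mul (n : ℕ) (x : ℂ) : eC (n * x) = eC x ^ n := by
  unfold eC; rw [← Complex.exp_nat_mul]; congr 1; ring

lemma eC_norm_lt (u : ℂ) (hu : 0 < u.im) : ‖eC u‖ < 1 := by
  have := UpperHalfPlane.norm_exp_two_pi_I_lt_one ⟨u, hu⟩
  simpa [eC] using this

lemma Phi_upper {q : ℕ} [NeZero q] (hq1 : 1 < q) (χ : DirichletCharacter ℂ q)
    (hχ : χ.IsPrimitive) (u : ℂ) (hu : 0 < u.im) :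
    Phi χ (q * u) = -(2 * Real.pi * I * gaussSum' χ / q) *
      ∑' k : ℕ+, (starRingEnd ℂ) (χ ((k : ℕ) : ZMod q)) * eC (k * u) := by
  have hq0 : (q : ℂ) ≠ 0 := by exact_mod_cast NeZero.ne q
  have him : ∀ s : ℕ, 0 < (u + s / q).im := by
    intro s
    have : ((s : ℂ) / q).im = 0 := by
      have : (s : ℂ) / q = ((s / q : ℝ) : ℂ) := by push_cast; rfl
      rw [this, ofReal_im]
    rw [add_im, this]; simpa using hu
  have h1 : ∀ s : ℕ, (Real.pi : ℂ) * Complex.cot (Real.pi * ((q * u + s) / q)) =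
      Real.pi * I - 2 * Real.pi * I * ∑' n : ℕ, eC (u + s / q) ^ n := by
    intro s
    have := pi_mul_cot_pi_q_exp ⟨u + s / q, him s⟩
    have e : (q * u + s) / q = u + s / q := by field_simp
    rw [e]
    exact this
  have h2 : Phi χ (q * u) = -(2 * Real.pi * I / q) *
      ∑ s ∈ Finset.range q, χ (s : ZMod q) * ∑' n : ℕ, eC (u + s / q) ^ n := by
    have h0 := char_sum_zero hq1 χ hχ
    unfold Phi
    calc _ = ∑ s ∈ Finset.range q, ((Real.pi * I / q) * χ (s : ZMod q) + -(2 * Real.pi * I / q) *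
          (χ (s : ZMod q) * ∑' n : ℕ, eC (u + s / q) ^ n)) := by
            apply Finset.sum_congr rfl
            intro s _
            rw [div_mul_eq_mul_div, h1]
            ring
      _ = _ := by
        rw [Finset.sum_add_distrib, ← Finset.mul_sum, ← Finset.mul_sum, h0]; ring
  have h3 : ∑ s ∈ Finset.range q, χ (s : ZMod q) * ∑' n : ℕ, eC (u + s / q) ^ n =
      ∑' n : ℕ, gaussSum' χ * ((starRingEnd ℂ) (χ (n : ZMod q)) * eC (n * u)) := by
    have hs : ∀ s ∈ Finset.range q, Summable (fun n : ℕ => χ (s : ZMod q) * eC (u + s / q) ^ n) :=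
      fun s _ => (summable_geometric_of_norm_lt_one (eC_norm_lt _ (him s))).mul_left _
    simp only [← tsum_mul_left]
    rw [← Summable.tsum_finsetSum hs]
    congr 1
    funext n
    have hg := gauss_twist χ hχ n
    have : ∀ s ∈ Finset.range q, χ (s : ZMod q) * eC (u + s / q) ^ n =
        eC (n * u) * (χ (s : ZMod q) * eC (s * (n : ℤ) / q)) := by
      intro s _
      rw [← eC_nat_mul, mul_add, eC_add, Int.cast_natCast]
      rw [show (n : ℂ) * (s / q) = s * n / q by ring]
      ring
    rw [Finset.sum_congr rfl this, ← Finset.mul_sum, hg, Int.cast_natCast]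
    ring
  rw [h2, h3, tsum_mul_left]
  have h4 : ∑' n : ℕ, (starRingEnd ℂ) (χ (n : ZMod q)) * eC (n * u) =
      ∑' k : ℕ+, (starRingEnd ℂ) (χ ((k : ℕ) : ZMod q)) * eC (k * u) := by
    symm
    apply tsum_pnat_eq_tsum_of_eq_zero (f := fun n : ℕ => (starRingEnd ℂ) (χ (n : ZMod q)) * eC (n * u))
    have : Fact (1 < q) := ⟨hq1⟩
    simp [MulChar.map_zero χ]
  rw [h4]
  ring

lemma cot_neg' (x : ℂ) : Complex.cot (-x) = -Complex.cot x := by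
  simp [Complex.cot, neg_div, div_neg]

lemma cot_sub_pi' (x : ℂ) : Complex.cot (x - Real.pi) = Complex.cot x := by
  simp [Complex.cot, Complex.cos_sub_pi, Complex.sin_sub_pi]

lemma Phi_neg {q : ℕ} [NeZero q] (hq1 : 1 < q) (χ : DirichletCharacter ℂ q) (w : ℂ) :
    Phi χ (-w) = - χ (-1) * Phi χ w := by
  have : Fact (1 < q) := ⟨hq1⟩
  have hq0 : (q : ℂ) ≠ 0 := by exact_mod_cast NeZero.ne q
  obtain ⟨m, rfl⟩ : ∃ m, q = m + 1 := ⟨q - 1, by omega⟩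
  unfold Phi
  rw [Finset.sum_range_succ', Finset.sum_range_succ']
  simp only [Nat.cast_zero, MulChar.map_zero, zero_mul, add_zero]
  rw [← Finset.sum_range_reflect, Finset.mul_sum]
  apply Finset.sum_congr rfl
  intro j hj
  simp only [Finset.mem_range] at hj
  have h1 : m - 1 - j + 1 = m - j := by omega
  have h2 : ((m - j : ℕ) : ZMod (m + 1)) = -1 * ((j + 1 : ℕ) : ZMod (m + 1)) := by
    have : ((m - j + (j + 1) : ℕ) : ZMod (m + 1)) = 0 := by
      rw [show m - j + (j + 1) = m + 1 by omega]; simp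
    rw [Nat.cast_add] at this
    rw [neg_one_mul]
    exact eq_neg_of_add_eq_zero_left this
  have h3 : (Real.pi : ℂ) * ((-w + (m - j : ℕ)) / (m + 1 : ℕ)) =
     - (Real.pi * ((w + (j + 1 : ℕ)) / (m + 1 : ℕ)) - Real.pi) := by
    rw [Nat.cast_sub hj.le]
    field_simp
    push_cast
    ring
  rw [h1, h2, map_mul, h3, cot_neg', cot_sub_pi']
  ring

lemma sum_Phi_eq_fE {q₁ q₂ : ℕ} [NeZero q₁] [NeZero q₂] (hq₁ : 1 < q₁) (hq₂ : 1 < q₂)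
    (χ₁ : DirichletCharacter ℂ q₁) (χ₂ : DirichletCharacter ℂ q₂) (hχ₂ : χ₂.IsPrimitive)
    (hpar : χ₁ (-1) * χ₂ (-1) = 1) (z : ℂ) (hz : 0 < z.im)
    (hs : Summable (fun l : ℤ => χ₁ (l : ZMod q₁) / l * Phi χ₂ (l * (q₂ * z)))) :
    ∑' l : ℤ, χ₁ (l : ZMod q₁) / l * Phi χ₂ (l * (q₂ * z)) =
      -(4 * Real.pi * I * gaussSum' χ₂ / q₂) * fE χ₁ χ₂ z := by
  rw [tsum_int_eq_zero_add_two_mul_tsum_pnat _ hs]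
  · simp only [Int.cast_zero, div_zero, zero_mul, zero_add]
    unfold fE
    rw [show -(4 * Real.pi * I * gaussSum' χ₂ / q₂) = 2 * -(2 * Real.pi * I * gaussSum' χ₂ / q₂) by
      ring, mul_assoc, ← tsum_mul_left (a := -(2 * Real.pi * I * gaussSum' χ₂ / q₂))]
    rw [nsmul_eq_mul, Nat.cast_ofNat]
    congr 2
    funext l
    have hl : (0 : ℝ) < (l : ℕ) := by exact_mod_cast l.pos
    have h := Phi_upper hq₂ χ₂ hχ₂ ((l : ℕ) * z) (by
      rw [← ofReal_natCast, im_ofReal_mul]; positivity)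
    have e : (((l : ℕ) : ℤ) : ℂ) * (q₂ * z) = q₂ * ((l : ℕ) * z) := by push_cast; ring
    rw [e, h]
    rw [mul_left_comm, ← tsum_mul_left (a := χ₁ _ / _)]
    congr 2
    funext k
    push_cast
    rw [mul_assoc (k : ℂ)]
    ring
  · intro l
    have := Phi_neg hq₂ χ₂ (l * (q₂ * z))
    have e : ((-l : ℤ) : ℂ) * (q₂ * z) = -(l * (q₂ * z)) := by push_cast; ring
    show χ₁ ((-l : ℤ) : ZMod q₁) / ((-l : ℤ) : ℂ) * Phi χ₂ (((-l : ℤ) : ℂ) * (q₂ * z)) =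
      χ₁ (l : ZMod q₁) / l * Phi χ₂ (l * (q₂ * z))
    rw [e, this]
    have h2 : χ₁ ((-l : ℤ) : ZMod q₁) = χ₁ (-1) * χ₁ (l : ZMod q₁) := by
      rw [← map_mul]; push_cast; ring_nf
    rw [h2]
    push_cast
    rw [div_neg]
    linear_combination (χ₁ (l : ZMod q₁) / l * Phi χ₂ (l * (q₂ * z))) * hpar

lemma re_lt_one {ζ : ℂ} (hζ : ‖ζ‖ = 1) (h1 : ζ ≠ 1) : ζ.re < 1 := by
  rcases lt_or_ge ζ.re 1 with h | h
  · exact h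
  · exfalso
    have h2 : ζ.re ^ 2 + ζ.im ^ 2 = 1 := by
      have := Complex.sq_norm ζ
      rw [hζ, Complex.normSq_apply] at this; nlinarith
    have h3 : ζ.im = 0 := by nlinarith [sq_nonneg ζ.im]
    have h4 : ζ.re = 1 := by nlinarith
    exact h1 (Complex.ext (by simpa using h4) (by simpa using h3))

lemma log_series {ζ : ℂ} (hζ : ‖ζ‖ = 1) (h1 : ζ ≠ 1) :
    Tendsto (fun N : ℕ => ∑ i ∈ Finset.range N, ζ ^ i / (i : ℂ)) atTop (𝓝 (-Complex.log (1 - ζ))) := by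
  have hre := re_lt_one hζ h1
  have hsub : ζ - 1 ≠ 0 := sub_ne_zero.mpr h1
  have hC : CauchySeq (fun n : ℕ => ∑ i ∈ Finset.range n, (1 / ((i : ℝ) + 1)) • ζ ^ (i + 1)) := by
    apply Antitone.cauchySeq_series_mul_of_tendsto_zero_of_bounded (b := 2 / ‖ζ - 1‖)
    · intro i j hij
      have : (i : ℝ) ≤ j := by exact_mod_cast hij
      show 1 / ((j : ℝ) + 1) ≤ 1 / ((i : ℝ) + 1)
      gcongr
    · exact tendsto_one_div_add_atTop_nhds_zero_nat
    · intro n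
      have : ∑ i ∈ Finset.range n, ζ ^ (i + 1) = ζ * ((ζ ^ n - 1) / (ζ - 1)) := by
        rw [← geom_sum_eq h1, Finset.mul_sum]
        apply Finset.sum_congr rfl
        intro i _; ring
      rw [this, norm_mul, hζ, one_mul, norm_div]
      gcongr
      calc ‖ζ ^ n - 1‖ ≤ ‖ζ ^ n‖ + ‖(1 : ℂ)‖ := norm_sub_le _ _
        _ = 2 := by rw [norm_pow, hζ]; norm_num
  obtain ⟨L, hL⟩ := cauchySeq_tendsto_of_complete hC
  have hL' : Tendsto (fun N : ℕ => ∑ i ∈ Finset.range N, ζ ^ i / (i : ℂ)) atTop (𝓝 L) := by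
    rw [← tendsto_add_atTop_iff_nat 1]
    refine hL.congr fun n => ?_
    rw [Finset.sum_range_succ']
    simp only [Nat.cast_zero, div_zero, add_zero]
    apply Finset.sum_congr rfl
    intro i _
    rw [Complex.real_smul]
    push_cast
    ring
  have hA := Complex.tendsto_tsum_powerSeries_nhdsWithin_lt hL'
  have hB : Tendsto (fun x : ℝ => -Complex.log (1 - x * ζ)) (𝓝[<] 1) (𝓝 (-Complex.log (1 - ζ))) := by
    have hc : ContinuousAt (fun x : ℝ => -Complex.log (1 - x * ζ)) 1 := by
      apply ContinuousAt.neg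
      apply ContinuousAt.clog
      · fun_prop
      · left; simp; exact hre
    have := hc.tendsto
    simp only [ofReal_one, one_mul] at this
    exact this.mono_left nhdsWithin_le_nhds
  have hE : L = -Complex.log (1 - ζ) := by
    rw [tendsto_map'_iff] at hA
    refine tendsto_nhds_unique hA (hB.congr' ?_)
    filter_upwards [Ioo_mem_nhdsLT (show (0 : ℝ) < 1 by norm_num)] with x hx
    have hn : ‖(x : ℂ) * ζ‖ < 1 := by
      rw [norm_mul, hζ, mul_one, Complex.norm_real, Real.norm_eq_abs, abs_of_pos hx.1]; exact hx.2
    rw [← (Complex.hasSum_taylorSeries_neg_log hn).tsum_eq]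
    simp only [Function.comp]
    congr 1
    funext n
    rw [mul_pow]; ring
  rw [hE] at hL'
  exact hL'

lemma eC_int (n : ℤ) : eC n = 1 := by
  unfold eC
  rw [← Complex.exp_int_mul_two_pi_mul_I n]
  congr 1; ring

lemma eC_norm (θ : ℝ) : ‖eC θ‖ = 1 := by
  unfold eC
  rw [show 2 * (Real.pi : ℂ) * I * θ = ((2 * Real.pi * θ : ℝ) : ℂ) * I by push_cast; ring]
  exact Complex.norm_exp_ofReal_mul_I _

lemma one_sub_eC (θ : ℂ) : 1 - eC θ = 2 * Complex.sin (Real.pi * θ) *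
    Complex.exp ((Real.pi * (θ - 1 / 2)) * I) := by
  have hI : Complex.exp (-(Real.pi / 2 * I)) = -I := by
    rw [Complex.exp_neg, Complex.exp_pi_div_two_mul_I, Complex.inv_I]
  have e1 : Complex.exp ((Real.pi * (θ - 1 / 2)) * I) = Complex.exp (Real.pi * θ * I) * (-I) := by
    rw [← hI, ← Complex.exp_add]; congr 1; ring
  have e2 : eC θ = Complex.exp (Real.pi * θ * I) ^ 2 := by
    unfold eC; rw [← Complex.exp_nat_mul]; congr 1; push_cast; ring
  rw [e1, e2, Complex.sin, neg_mul, Complex.exp_neg]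
  have := Complex.exp_ne_zero (Real.pi * θ * I)
  field_simp
  rw [I_sq]; ring

lemma log_one_sub_eC {θ : ℝ} (h0 : 0 < θ) (h1 : θ < 1) :
    Complex.log (1 - eC θ) = Real.log (2 * Real.sin (Real.pi * θ)) + Real.pi * (θ - 1 / 2) * I := by
  have hs : 0 < Real.sin (Real.pi * θ) := Real.sin_pos_of_pos_of_lt_pi (by positivity)
    (by nlinarith [Real.pi_pos])
  rw [one_sub_eC]
  have : 2 * Complex.sin (Real.pi * θ) = ((2 * Real.sin (Real.pi * θ) : ℝ) : ℂ) := by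
    push_cast; rfl
  rw [this, Complex.log_ofReal_mul (by positivity) (Complex.exp_ne_zero _), Complex.log_exp]
  · have : ((Real.pi : ℂ) * (θ - 1 / 2) * I).im = Real.pi * (θ - 1 / 2) := by
      rw [show (Real.pi : ℂ) * (θ - 1 / 2) = ((Real.pi * (θ - 1 / 2) : ℝ) : ℂ) by push_cast; rfl]
      simp
    rw [this]; nlinarith [Real.pi_pos]
  · have : ((Real.pi : ℂ) * (θ - 1 / 2) * I).im = Real.pi * (θ - 1 / 2) := by
      rw [show (Real.pi : ℂ) * (θ - 1 / 2) = ((Real.pi * (θ - 1 / 2) : ℝ) : ℂ) by push_cast; rfl]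
      simp
    rw [this]; nlinarith [Real.pi_pos]

lemma eC_fract (θ : ℝ) : eC ((Int.fract θ : ℝ) : ℂ) = eC θ := by
  have : (θ : ℂ) = (Int.fract θ : ℝ) + ((⌊θ⌋ : ℤ) : ℂ) := by
    have := Int.fract_add_floor θ
    exact_mod_cast this.symm
  rw [this, eC_add, eC_int, mul_one]

lemma eC_ne_one {θ : ℝ} (h : Int.fract θ ≠ 0) : eC θ ≠ 1 := by
  intro h1
  unfold eC at h1
  rw [Complex.exp_eq_one_iff] at h1
  obtain ⟨n, hn⟩ := h1
  have hp : (2 * (Real.pi : ℂ) * I) ≠ 0 := Complex.two_pi_I_ne_zero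
  have : (θ : ℂ) = (n : ℂ) := mul_left_cancel₀ hp (by rw [hn]; ring)
  have h2 : θ = n := by exact_mod_cast this
  rw [h2] at h; simp at h

lemma log_diff {θ : ℝ} (h : Int.fract θ ≠ 0) :
    -Complex.log (1 - eC θ) - -Complex.log (1 - eC (-θ)) = -2 * Real.pi * I * B1 θ := by
  have hpos : 0 < Int.fract θ := lt_of_le_of_ne (Int.fract_nonneg θ) (Ne.symm h)
  have hlt := Int.fract_lt_one θ
  have e1 := log_one_sub_eC hpos hlt
  have e2 := log_one_sub_eC (θ := 1 - Int.fract θ) (by linarith) (by linarith)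
  rw [eC_fract] at e1
  have e3 : eC ((1 - Int.fract θ : ℝ) : ℂ) = eC (-θ) := by
    have : ((1 - Int.fract θ : ℝ) : ℂ) = -θ + ((⌊θ⌋ + 1 : ℤ) : ℂ) := by
      have := Int.fract_add_floor θ
      have h2 : 1 - Int.fract θ = -θ + ((⌊θ⌋ + 1 : ℤ) : ℝ) := by push_cast; linarith
      rw [h2]; push_cast; rfl
    rw [this, eC_add, eC_int, mul_one]
  rw [e3] at e2
  have e4 : Real.sin (Real.pi * (1 - Int.fract θ)) = Real.sin (Real.pi * Int.fract θ) := by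
    rw [mul_sub, mul_one, Real.sin_pi_sub]
  rw [e4] at e2
  rw [e1, e2, B1, if_neg h]
  push_cast
  ring

lemma sum_Ico_sym (F : ℤ → ℂ) (X : ℕ) (h0 : F 0 = 0) :
    ∑ l ∈ Finset.Ico (-X : ℤ) X, F l =
      ∑ i ∈ Finset.range X, F i + ∑ i ∈ Finset.range (X + 1), F (-i) := by
  induction X with
  | zero => simp [h0]
  | succ m ih =>
    have h1 : Finset.Ico (-(m + 1 : ℕ) : ℤ) ((m + 1 : ℕ)) =
      insert (-(m + 1 : ℤ)) (insert (m : ℤ) (Finset.Ico (-m : ℤ) m)) := by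
      ext y; simp; omega
    rw [h1, Finset.sum_insert (by simp), Finset.sum_insert (by simp), ih,
      Finset.sum_range_succ (fun i : ℕ => F i) m,
      Finset.sum_range_succ (fun i : ℕ => F (-i)) (m + 1)]
    push_cast
    ring

lemma saw_series {θ : ℝ} (h : Int.fract θ ≠ 0) :
    Tendsto (fun X : ℕ => ∑ l ∈ Finset.Ico (-X : ℤ) X, eC (l * θ) / (l : ℂ)) atTop
      (𝓝 (-2 * Real.pi * I * B1 θ)) := by
  have h1 := log_series (eC_norm θ) (eC_ne_one h)
  have hinv : eC (-θ) = (eC θ)⁻¹ := by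
    unfold eC; rw [← Complex.exp_neg]; congr 1; ring
  have hn : ‖eC (-θ)‖ = 1 := by rw [hinv, norm_inv, eC_norm, inv_one]
  have h2 := log_series hn (by rw [hinv]; simpa using eC_ne_one h)
  have h3 := h1.sub ((tendsto_add_atTop_iff_nat 1).mpr h2)
  rw [log_diff h] at h3
  refine h3.congr fun X => ?_
  rw [sum_Ico_sym _ _ (by simp), sub_eq_add_neg, ← Finset.sum_neg_distrib]
  congr 1
  · apply Finset.sum_congr rfl
    intro i _
    rw [← eC_nat_mul]; push_cast; rfl
  · apply Finset.sum_congr rfl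
    intro i _
    rw [← eC_nat_mul]; push_cast
    rw [div_neg, mul_neg, neg_mul]

lemma sum_nat_mul_pow (ζ : ℂ) (n : ℕ) :
    (∑ j ∈ Finset.range n, (j : ℂ) * ζ ^ j) * (ζ - 1) =
      n * ζ ^ n - ζ * ∑ j ∈ Finset.range n, ζ ^ j := by
  induction n with
  | zero => simp
  | succ n ih =>
    rw [Finset.sum_range_succ, Finset.sum_range_succ, add_mul, ih]
    push_cast
    ring

lemma B1_dft {c : ℕ} (hc : 0 < c) {ζ : ℂ} (h1 : ζ ≠ 1) (hζ : ζ ^ c = 1) :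
    ∑ j ∈ Finset.range c, (B1 ((j : ℝ) / c) : ℂ) * ζ ^ j = 1 / (ζ - 1) + 1 / 2 := by
  have hsub : ζ - 1 ≠ 0 := sub_ne_zero.mpr h1
  have hc0 : (c : ℂ) ≠ 0 := by exact_mod_cast hc.ne'
  have hcR : (0 : ℝ) < c := by exact_mod_cast hc
  have hg : ∑ j ∈ Finset.range c, ζ ^ j = 0 := by
    rw [geom_sum_eq h1, hζ]; simp
  have hs := sum_nat_mul_pow ζ c
  rw [hg, hζ] at hs
  have hs' : ∑ j ∈ Finset.range c, (j : ℂ) * ζ ^ j = c / (ζ - 1) := by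
    rw [eq_div_iff hsub, hs]; ring
  have hB : ∀ j ∈ Finset.range c, (B1 ((j : ℝ) / c) : ℂ) * ζ ^ j =
      (1 / c * ((j : ℂ) * ζ ^ j) - 1 / 2 * ζ ^ j) + (if j = 0 then 1 / 2 else 0) := by
    intro j hj
    simp only [Finset.mem_range] at hj
    rcases Nat.eq_zero_or_pos j with rfl | hj0
    · simp [B1]
    · have hjR : (0 : ℝ) < j := by exact_mod_cast hj0
      have hlt : (j : ℝ) / c < 1 := by
        rw [div_lt_one hcR]; exact_mod_cast hj
      have hf : Int.fract ((j : ℝ) / c) = j / c := Int.fract_eq_self.mpr ⟨by positivity, hlt⟩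
      have hne : (j : ℝ) / c ≠ 0 := by positivity
      rw [B1, hf, if_neg hne, if_neg hj0.ne']
      push_cast
      ring
  rw [Finset.sum_congr rfl hB, Finset.sum_add_distrib, Finset.sum_sub_distrib, ← Finset.mul_sum,
    ← Finset.mul_sum, hs', hg, Finset.sum_ite_eq' , if_pos (by simpa using hc)]
  field_simp
  ring

lemma cot_dft {c : ℕ} (hc : 0 < c) {θ : ℂ} (h1 : eC θ ≠ 1) (hζ : eC θ ^ c = 1) :
    Complex.cot (Real.pi * θ) =
      2 * I * ∑ j ∈ Finset.range c, (B1 ((j : ℝ) / c) : ℂ) * eC θ ^ j := by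
  rw [B1_dft hc h1 hζ, Complex.cot_eq_exp_ratio]
  have e : Complex.exp (2 * I * (Real.pi * θ)) = eC θ := by
    unfold eC; congr 1; ring
  rw [e]
  have hsub : eC θ - 1 ≠ 0 := sub_ne_zero.mpr h1
  have hsub' : 1 - eC θ ≠ 0 := sub_ne_zero.mpr (Ne.symm h1)
  have hI := I_ne_zero
  rw [div_eq_iff (mul_ne_zero hI hsub')]
  have : 2 * I * (1 / (eC θ - 1) + 1 / 2) * (I * (1 - eC θ)) =
     I ^ 2 * (2 * (1 / (eC θ - 1) + 1 / 2) * (1 - eC θ)) := by ring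
  rw [this, I_sq]
  field_simp
  ring

lemma Phi_rat {q : ℕ} [NeZero q] (χ : DirichletCharacter ℂ q)
    (hχ : χ.IsPrimitive) {c : ℕ} (hc : 0 < c) (x : ℂ)
    (h1 : ∀ s : ℕ, eC (x + s / q) ≠ 1) (h2 : ∀ s : ℕ, eC (x + s / q) ^ c = 1) :
    Phi χ (q * x) = 2 * Real.pi * I * gaussSum' χ / q *
      ∑ j ∈ Finset.range c, (starRingEnd ℂ) (χ (j : ZMod q)) * B1 ((j : ℝ) / c) * eC (j * x) := by
  have hq0 : (q : ℂ) ≠ 0 := by exact_mod_cast NeZero.ne q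
  unfold Phi
  have step : ∀ s ∈ Finset.range q,
      χ (s : ZMod q) * (Real.pi / q * Complex.cot (Real.pi * ((q * x + s) / q))) =
      ∑ j ∈ Finset.range c, 2 * Real.pi * I / q * (B1 ((j : ℝ) / c) * eC (j * x)) *
        (χ (s : ZMod q) * eC (s * (j : ℤ) / q)) := by
    intro s _
    have e : (q * x + s) / q = x + s / q := by field_simp
    rw [e, cot_dft hc (h1 s) (h2 s), Finset.mul_sum, Finset.mul_sum, Finset.mul_sum]
    apply Finset.sum_congr rfl
    intro j _
    rw [← eC_nat_mul, mul_add, eC_add, Int.cast_natCast,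
      show (j : ℂ) * (s / q) = s * j / q by ring]
    ring
  rw [Finset.sum_congr rfl step, Finset.sum_comm, Finset.mul_sum]
  apply Finset.sum_congr rfl
  intro j _
  rw [← Finset.mul_sum, gauss_twist χ hχ, Int.cast_natCast]
  ring

lemma eC_eq_one {w : ℂ} (h : eC w = 1) : ∃ m : ℤ, w = m := by
  unfold eC at h
  rw [Complex.exp_eq_one_iff] at h
  obtain ⟨n, hn⟩ := h
  exact ⟨n, mul_left_cancel₀ Complex.two_pi_I_ne_zero (by rw [hn]; ring)⟩

lemma char_zero_of_dvd {q : ℕ} (hq : 1 < q) (χ : DirichletCharacter ℂ q) {l : ℤ}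
    (h : (q : ℤ) ∣ l) : χ (l : ZMod q) = 0 := by
  have : Fact (1 < q) := ⟨hq⟩
  rw [(ZMod.intCast_zmod_eq_zero_iff_dvd l q).mpr h]
  exact MulChar.map_zero χ

lemma dvd_of_dvd_mul {q a b c d l : ℤ} (hdet : a * d - b * c = 1) (hqc : q ∣ c) (h : q ∣ l * a) :
    q ∣ l := by
  have : l = (l * a) * d - (l * b) * c := by linear_combination -l * hdet
  rw [this]
  exact dvd_sub (h.mul_right _) (hqc.mul_left _)

lemma condA {q₁ q₂ C : ℕ} (hq₂ : 0 < q₂) (hq₁ : 0 < q₁) (hC : 0 < C) (hdvd : q₁ * q₂ ∣ C) {a b d : ℤ}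
    (hdet : a * d - b * C = 1) (l : ℤ) (hl : ¬ (q₁ : ℤ) ∣ l) (s : ℕ) :
    eC ((l * a / C : ℂ) + s / q₂) ≠ 1 := by
  intro h
  obtain ⟨m, hm⟩ := eC_eq_one h
  obtain ⟨k, hk⟩ := hdvd
  have hC0 : (C : ℂ) ≠ 0 := by exact_mod_cast hC.ne'
  have hq0 : (q₂ : ℂ) ≠ 0 := by exact_mod_cast hq₂.ne'
  have hkC : (C : ℂ) = q₁ * q₂ * k := by exact_mod_cast hk
  have e : (l * a + s * (q₁ * k) : ℂ) = m * C := by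
    rw [← hm, add_mul, div_mul_cancel₀ _ hC0, hkC]
    field_simp
  have e' : l * a + s * (q₁ * k) = m * C := by exact_mod_cast e
  have hqC : (q₁ : ℤ) ∣ C := by rw [hk]; push_cast; exact ⟨q₂ * k, by ring⟩
  apply hl
  apply dvd_of_dvd_mul hdet hqC
  have : l * a = m * C - q₁ * (s * k) := by linear_combination e'
  rw [this]
  exact dvd_sub (hqC.mul_left _) (dvd_mul_right _ _)

lemma condA' {q₂ C : ℕ} (hq₂ : 0 < q₂) (hC : 0 < C) (hdvd : q₂ ∣ C) (l a : ℤ) (s : ℕ) :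
    eC ((l * a / C : ℂ) + s / q₂) ^ C = 1 := by
  obtain ⟨k, hk⟩ := hdvd
  have hC0 : (C : ℂ) ≠ 0 := by exact_mod_cast hC.ne'
  have hq0 : (q₂ : ℂ) ≠ 0 := by exact_mod_cast hq₂.ne'
  have hkC : (C : ℂ) = q₂ * k := by exact_mod_cast hk
  rw [← eC_nat_mul, ← eC_int (l * a + s * k)]
  congr 1
  rw [mul_add, mul_div_cancel₀ _ hC0, hkC]
  push_cast
  field_simp

lemma condB {q₁ q₂ C : ℕ} (hq₁ : 0 < q₁) (hC : 0 < C) (hdvd : q₁ * q₂ ∣ C) {a b d : ℤ}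
    (hdet : a * d - b * C = 1) (j n : ℕ) (hj : ¬ (q₂ : ℤ) ∣ j) :
    Int.fract ((n : ℝ) / q₁ + a * j / C) ≠ 0 := by
  intro h
  have hm := Int.fract_add_floor ((n : ℝ) / q₁ + a * j / C)
  rw [h, zero_add] at hm
  set m := ⌊(n : ℝ) / q₁ + a * j / C⌋
  obtain ⟨k, hk⟩ := hdvd
  have hC0 : (C : ℝ) ≠ 0 := by exact_mod_cast hC.ne'
  have hq0 : (q₁ : ℝ) ≠ 0 := by exact_mod_cast hq₁.ne'
  have hkC : (C : ℝ) = q₁ * q₂ * k := by exact_mod_cast hk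
  have e : (j * a + n * (q₂ * k) : ℝ) = m * C := by
    rw [hm, add_mul, div_mul_cancel₀ _ hC0, hkC]
    field_simp
    ring
  have e' : j * a + n * (q₂ * k) = m * C := by exact_mod_cast e
  have hqC : (q₂ : ℤ) ∣ C := by rw [hk]; push_cast; exact ⟨q₁ * k, by ring⟩
  apply hj
  apply dvd_of_dvd_mul hdet hqC
  have : j * a = m * C - q₂ * (n * k) := by linear_combination e'
  rw [this]
  exact dvd_sub (hqC.mul_left _) (dvd_mul_right _ _)

lemma limit_eval {q₁ q₂ C : ℕ} [NeZero q₁] [NeZero q₂] (hq₁ : 1 < q₁) (hq₂ : 1 < q₂)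
    (χ₁ : DirichletCharacter ℂ q₁) (χ₂ : DirichletCharacter ℂ q₂)
    (hχ₁ : χ₁.IsPrimitive) (hχ₂ : χ₂.IsPrimitive) (hC : 0 < C) (hdvd : q₁ * q₂ ∣ C) {a b d : ℤ}
    (hdet : a * d - b * C = 1) :
    Tendsto (fun X : ℕ => gaussSum' (χ₁.ringHomComp (starRingEnd ℂ)) *
      ∑ l ∈ Finset.Ico (-X : ℤ) X, χ₁ (l : ZMod q₁) / l * Phi χ₂ (q₂ * (l * a / C))) atTop
      (𝓝 (2 * Real.pi * I * gaussSum' χ₂ / q₂ * (-2 * Real.pi * I) *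
        ∑ j ∈ Finset.range C, ∑ n ∈ Finset.range q₁,
          (starRingEnd ℂ) (χ₂ (j : ZMod q₂)) * (starRingEnd ℂ) (χ₁ (n : ZMod q₁)) *
            (B1 ((j : ℝ) / C) : ℂ) * (B1 ((n : ℝ) / q₁ + (a : ℝ) * j / C) : ℂ))) := by
  have hC0 : (C : ℂ) ≠ 0 := by exact_mod_cast hC.ne'
  have hpt : ∀ l : ℤ, gaussSum' (χ₁.ringHomComp (starRingEnd ℂ)) *
      (χ₁ (l : ZMod q₁) / l * Phi χ₂ (q₂ * (l * a / C))) =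
      ∑ j ∈ Finset.range C, ∑ n ∈ Finset.range q₁,
        2 * Real.pi * I * gaussSum' χ₂ / q₂ * ((starRingEnd ℂ) (χ₂ (j : ZMod q₂)) *
          (starRingEnd ℂ) (χ₁ (n : ZMod q₁)) * (B1 ((j : ℝ) / C) : ℂ)) *
            (eC (l * ((n : ℝ) / q₁ + (a : ℝ) * j / C : ℝ)) / l) := by
    intro l
    have hR : ∀ j ∈ Finset.range C, ∑ n ∈ Finset.range q₁,
        2 * Real.pi * I * gaussSum' χ₂ / q₂ * ((starRingEnd ℂ) (χ₂ (j : ZMod q₂)) *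
          (starRingEnd ℂ) (χ₁ (n : ZMod q₁)) * (B1 ((j : ℝ) / C) : ℂ)) *
            (eC (l * ((n : ℝ) / q₁ + (a : ℝ) * j / C : ℝ)) / l) =
        (χ₁ (l : ZMod q₁) * gaussSum' (χ₁.ringHomComp (starRingEnd ℂ)) / l) *
         (2 * Real.pi * I * gaussSum' χ₂ / q₂ * ((starRingEnd ℂ) (χ₂ (j : ZMod q₂)) *
           B1 ((j : ℝ) / C) * eC (j * (l * a / C)))) := by
      intro j _
      rw [← gauss_twist_conj χ₁ hχ₁ l, Finset.sum_div, Finset.sum_mul]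
      apply Finset.sum_congr rfl
      intro n _
      have : (l : ℂ) * ((n : ℝ) / q₁ + (a : ℝ) * j / C : ℝ) = n * l / q₁ + j * (l * a / C) := by
        push_cast; ring
      rw [this, eC_add]
      ring
    rw [Finset.sum_congr rfl hR, ← Finset.mul_sum, ← Finset.mul_sum]
    by_cases hl : (q₁ : ℤ) ∣ l
    · rw [char_zero_of_dvd hq₁ χ₁ hl]; simp
    · rw [Phi_rat χ₂ hχ₂ hC (l * a / C)
        (condA (by omega) (by omega) hC hdvd hdet l hl)
        (condA' (by omega) hC ((Dvd.intro_left _ rfl).trans hdvd) l a)]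
      ring
  have hX : ∀ X : ℕ, gaussSum' (χ₁.ringHomComp (starRingEnd ℂ)) *
      ∑ l ∈ Finset.Ico (-X : ℤ) X, χ₁ (l : ZMod q₁) / l * Phi χ₂ (q₂ * (l * a / C)) =
      ∑ j ∈ Finset.range C, ∑ n ∈ Finset.range q₁,
        2 * Real.pi * I * gaussSum' χ₂ / q₂ * ((starRingEnd ℂ) (χ₂ (j : ZMod q₂)) *
          (starRingEnd ℂ) (χ₁ (n : ZMod q₁)) * (B1 ((j : ℝ) / C) : ℂ)) *
            ∑ l ∈ Finset.Ico (-X : ℤ) X, (eC (l * ((n : ℝ) / q₁ + (a : ℝ) * j / C : ℝ)) / l) := by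
    intro X
    rw [Finset.mul_sum, Finset.sum_congr rfl (fun l _ => hpt l), Finset.sum_comm]
    apply Finset.sum_congr rfl
    intro j _
    rw [Finset.sum_comm]
    apply Finset.sum_congr rfl
    intro n _
    rw [Finset.mul_sum]
  simp_rw [hX, Finset.mul_sum]
  simp_rw [← Finset.mul_sum]
  rw [Finset.mul_sum]
  refine tendsto_finsetSum _ fun j _ => ?_
  rw [Finset.mul_sum]
  refine tendsto_finsetSum _ fun n _ => ?_
  by_cases hj : (q₂ : ℤ) ∣ j
  · have := char_zero_of_dvd hq₂ χ₂ hj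
    rw [Int.cast_natCast] at this
    rw [this]; simp
  · have := (saw_series (condB (by omega) hC hdvd hdet j n hj)).const_mul
      (2 * Real.pi * I * gaussSum' χ₂ / q₂ * ((starRingEnd ℂ) (χ₂ (j : ZMod q₂)) *
          (starRingEnd ℂ) (χ₁ (n : ZMod q₁)) * (B1 ((j : ℝ) / C) : ℂ)))
    convert this using 2
    ring
lemma moebius_im {a b c d : ℤ} (hdet : a * d - b * c = 1) {z : ℂ} (hz : 0 < z.im)
    (hne : (c : ℂ) * z + d ≠ 0) : 0 < (((a : ℂ) * z + b) / ((c : ℂ) * z + d)).im := by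
  have hn : 0 < Complex.normSq ((c : ℂ) * z + d) := Complex.normSq_pos.mpr hne
  have hd : (a : ℝ) * d - b * c = 1 := by exact_mod_cast hdet
  rw [Complex.div_im]
  have : ((a : ℂ) * z + b).im * ((c : ℂ) * z + d).re / Complex.normSq ((c : ℂ) * z + d) -
      ((a : ℂ) * z + b).re * ((c : ℂ) * z + d).im / Complex.normSq ((c : ℂ) * z + d) =
      z.im / Complex.normSq ((c : ℂ) * z + d) := by
    rw [← sub_div]
    congr 1
    simp
    linear_combination z.im * hd
  rw [this]
  positivity

theorem dedekind_sum_finite_evaluation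
    {q₁ q₂ : ℕ} (hq₁ : 1 < q₁) (hq₂ : 1 < q₂)
    (χ₁ : DirichletCharacter ℂ q₁) (χ₂ : DirichletCharacter ℂ q₂)
    (hχ₁ : χ₁.IsPrimitive) (hχ₂ : χ₂.IsPrimitive)
    (hpar : χ₁ (-1) * χ₂ (-1) = 1)
    (a b c d : ℤ) (hdet : a * d - b * c = 1) (hΓ : ((q₁ * q₂ : ℕ) : ℤ) ∣ c) (hc : 1 ≤ c)
    (z : ℂ) (hz : 0 < z.im) :
    gaussSum' (χ₁.ringHomComp (starRingEnd ℂ)) / (Real.pi * Complex.I) *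
      (fE χ₁ χ₂ (((a : ℂ) * z + (b : ℂ)) / ((c : ℂ) * z + (d : ℂ))) -
        χ₁ ((d : ℤ) : ZMod q₁) * (starRingEnd ℂ) (χ₂ ((d : ℤ) : ZMod q₂)) * fE χ₁ χ₂ z) =
    ∑ j ∈ Finset.range c.toNat, ∑ n ∈ Finset.range q₁,
      (starRingEnd ℂ) (χ₂ ((j : ℕ) : ZMod q₂)) * (starRingEnd ℂ) (χ₁ ((n : ℕ) : ZMod q₁)) *
        (B1 ((j : ℝ) / (c : ℝ)) : ℂ) *
        (B1 ((n : ℝ) / (q₁ : ℝ) + (a : ℝ) * (j : ℝ) / (c : ℝ)) : ℂ) := by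
  have : NeZero q₁ := ⟨by omega⟩
  have : NeZero q₂ := ⟨by omega⟩
  obtain ⟨C, rfl⟩ : ∃ C : ℕ, c = C := ⟨c.toNat, by omega⟩
  have hC : 0 < C := by omega
  have hdvd : q₁ * q₂ ∣ C := by exact_mod_cast hΓ
  obtain ⟨k, hk⟩ := id hdvd
  have hk0 : 0 < k := by
    rcases Nat.eq_zero_or_pos k with h | h
    · rw [h] at hk; omega
    · exact h
  have hkC : (C : ℂ) = q₁ * q₂ * k := by exact_mod_cast hk
  have hkZ : (C : ℤ) = q₁ * q₂ * k := by exact_mod_cast hk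
  have hq20 : (q₂ : ℂ) ≠ 0 := by exact_mod_cast NeZero.ne q₂
  have hq10 : (q₁ : ℂ) ≠ 0 := by exact_mod_cast NeZero.ne q₁
  have hkc0 : (k : ℂ) ≠ 0 := by exact_mod_cast hk0.ne'
  have hq2R : (0 : ℝ) < q₂ := by exact_mod_cast (show 0 < q₂ by omega)
  have hne : ((C : ℤ) : ℂ) * z + d ≠ 0 := by
    intro h
    have h2 := congrArg Complex.im h
    simp at h2
    rcases h2 with h2 | h2
    · omega
    · exact hz.ne' h2
  have hz' := moebius_im hdet hz hne
  set z' := ((a : ℂ) * z + (b : ℂ)) / (((C : ℤ) : ℂ) * z + (d : ℂ)) with hz'def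
  have hzz : z' * (((C : ℤ) : ℂ) * z + d) = a * z + b := div_mul_cancel₀ _ hne
  -- residues
  have ha1 : (a : ZMod q₁) * d = 1 := by
    have := congrArg (Int.cast : ℤ → ZMod q₁) hdet
    rw [hkZ] at this
    push_cast at this
    simpa using this
  have ha2 : (a : ZMod q₂) * d = 1 := by
    have := congrArg (Int.cast : ℤ → ZMod q₂) hdet
    rw [hkZ] at this
    push_cast at this
    simpa using this
  have hx1 : χ₁ (a : ZMod q₁) * χ₁ (d : ZMod q₁) = 1 := by rw [← map_mul, ha1, map_one]
  have hx2 : χ₂ (a : ZMod q₂) * χ₂ (d : ZMod q₂) = 1 := by rw [← map_mul, ha2, map_one]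
  have hx2' : (starRingEnd ℂ) (χ₂ (d : ZMod q₂)) * χ₂ (d : ZMod q₂) = 1 := by
    have hu : IsUnit (d : ZMod q₂) := IsUnit.of_mul_eq_one _ (by rw [mul_comm]; exact ha2)
    have hn : ‖χ₂ (d : ZMod q₂)‖ = 1 := by
      obtain ⟨v, hv⟩ := hu
      rw [← hv]; exact χ₂.unit_norm_eq_one v
    rw [mul_comm, Complex.mul_conj, Complex.normSq_eq_norm_sq, hn]; norm_num
  have hcore := core_main (α := fun l => χ₁ (l : ZMod q₁)) (p := charP χ₂)
    (β := fun n => χ₂ (n : ZMod q₂)) (charP_succ hq₂ χ₂ hχ₂) (q := q₂) (by omega)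
    (charP_mul χ₂) q₂ (charP_bound χ₂) (fun l => χ₁.norm_le_one _)
    (char_zero_of_dvd hq₁ χ₁ (dvd_zero _)) (Phi χ₂) (Phi_tendsto χ₂)
    a (q₂ * b) (q₁ * k) d (by linear_combination hdet + b * hkZ) (by positivity)
    (χ₁ (a : ZMod q₁) * χ₂ (d : ZMod q₂))
    (by
      intro l n
      have e1 : ((l * a + n * (q₁ * k) : ℤ) : ZMod q₁) = l * a := by push_cast; simp
      have e2 : ((l * (q₂ * b) + n * d : ℤ) : ZMod q₂) = n * d := by push_cast; simp
      simp only [e1, e2, map_mul]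
      ring)
    (by
      intro l n hl h0
      apply hl
      apply char_zero_of_dvd hq₁
      apply dvd_of_dvd_mul hdet (q := q₁) ⟨q₂ * k, by rw [hkZ]; ring⟩
      exact ⟨-(n * k), by linear_combination h0⟩)
    (q₂ * z) (by rw [← ofReal_natCast, im_ofReal_mul]; positivity)
    (q₂ * z') (by rw [← ofReal_natCast, im_ofReal_mul]; positivity)
    (by
      push_cast
      push_cast at hzz
      rw [hkC] at hzz
      linear_combination q₂ * hzz)
  obtain ⟨hs1, hs2, hlim⟩ := hcore
  have E1 := sum_Phi_eq_fE hq₁ hq₂ χ₁ χ₂ hχ₂ hpar z hz hs1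
  have E2 := sum_Phi_eq_fE hq₁ hq₂ χ₁ χ₂ hχ₂ hpar z' hz' hs2
  rw [E1, E2] at hlim
  have hlim2 := (limit_eval hq₁ hq₂ χ₁ χ₂ hχ₁ hχ₂ hC hdvd hdet).const_mul
    (χ₁ (a : ZMod q₁) * χ₂ (d : ZMod q₂))
  have hlim3 := hlim.const_mul (gaussSum' (χ₁.ringHomComp (starRingEnd ℂ)))
  have hU := tendsto_nhds_unique hlim3 (hlim2.congr fun X => by
    rw [mul_left_comm]
    congr 3
    funext l
    congr 2
    rw [hkC]
    push_cast
    field_simp)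
  rw [Int.toNat_natCast]
  simp only [Int.cast_natCast]
  set S := ∑ j ∈ Finset.range C, ∑ n ∈ Finset.range q₁,
          (starRingEnd ℂ) (χ₂ (j : ZMod q₂)) * (starRingEnd ℂ) (χ₁ (n : ZMod q₁)) *
            (B1 ((j : ℝ) / C) : ℂ) * (B1 ((n : ℝ) / q₁ + (a : ℝ) * j / C) : ℂ) with hS
  have hτ := gauss_ne_zero χ₂ hχ₂
  have hpi : (Real.pi : ℂ) ≠ 0 := by exact_mod_cast Real.pi_ne_zero
  have hK : (-(4 * Real.pi * I * gaussSum' χ₂ / q₂)) ≠ 0 := by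
    have := I_ne_zero
    rw [neg_ne_zero]
    exact div_ne_zero (mul_ne_zero (mul_ne_zero (mul_ne_zero (by norm_num) hpi) this) hτ) hq20
  rw [div_mul_eq_mul_div, div_eq_iff (mul_ne_zero hpi I_ne_zero)]
  apply mul_left_cancel₀ hK
  have hκ : (χ₁ (d : ZMod q₁) * (starRingEnd ℂ) (χ₂ (d : ZMod q₂))) *
     (χ₁ (a : ZMod q₁) * χ₂ (d : ZMod q₂)) = 1 := by
    linear_combination hx2' * (χ₁ (a : ZMod q₁) * χ₁ (d : ZMod q₁)) + hx1
  set ψ := χ₁ (d : ZMod q₁) * (starRingEnd ℂ) (χ₂ (d : ZMod q₂))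
  set κ := χ₁ (a : ZMod q₁) * χ₂ (d : ZMod q₂)
  set K := -(4 * Real.pi * I * gaussSum' χ₂ / q₂) with hKdef
  set T := gaussSum' (χ₁.ringHomComp (starRingEnd ℂ))
  have hconst : 2 * Real.pi * I * gaussSum' χ₂ / q₂ * (-2 * Real.pi * I) = K * (Real.pi * I) := by
    rw [hKdef]; ring
  rw [hconst] at hU
  linear_combination ψ * hU + (K * (Real.pi * I) * S - T * K * fE χ₁ χ₂ z') * hκ
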